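/- arXiv:1202.0392 — 14 statements merged into one kernel-verified Lean document; each statement's English description precedes it below -/
import Mathlib

section
/- Let X be a nonzero R-module. The following are equivalent: (1) X is an M-prime module; (2) for every submodule N of M and every nonzero submodule Y of X, N·Y = 0 implies N·X = 0; (3) for every M-ideal N of M and every nonzero submodule Y of X, N·Y = 0 implies N·X = 0; (4) Ann_M(Y₁) = Ann_M(Y₂) for all nonzero submodules Y₁, Y₂ of X; (5) every nonzero submodule of X is an M-prime module. -/
universe u v

section BeachyDefs

variable (R : Type u) [Ring R]

/-- The Beachy product `N·X`: the smallest submodule `Y` of `X` such that `f(N) = 0`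
for every `R`-homomorphism `f : M → X/Y`, i.e. the intersection of all such submodules. -/
def bprod (M : Type*) [AddCommGroup M] [Module R M]
    (X : Type*) [AddCommGroup X] [Module R X] (N : Submodule R M) : Submodule R X :=
  sInf {Y : Submodule R X | ∀ f : M →ₗ[R] X ⧸ Y, ∀ n ∈ N, f n = 0}

/-- The product `N·Z` for a submodule `Z` of `X`, computed with `Z` regarded as an
`R`-module and viewed as a submodule of `X`. -/
def bprodSub (M : Type*) [AddCommGroup M] [Module R M]
    (X : Type*) [AddCommGroup X] [Module R X] (N : Submodule R M) (Z : Submodule R X) :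
    Submodule R X :=
  (bprod R M (↥Z) N).map Z.subtype

/-- `N² := N·N`, a submodule of `M`. -/
def msq (M : Type*) [AddCommGroup M] [Module R M] (N : Submodule R M) : Submodule R M :=
  bprodSub R M M N N

/-- `Ann_M(X) = ⋂ { ker f : f ∈ Hom_R(M,X) }`, a submodule of `M`. -/
def annM (M : Type*) [AddCommGroup M] [Module R M]
    (X : Type*) [AddCommGroup X] [Module R X] : Submodule R M :=
  ⨅ f : M →ₗ[R] X, LinearMap.ker f

/-- A proper submodule `P` of `X` is `M`-prime if `N·Y ⊆ P` implies `N·X ⊆ P` or `Y ⊆ P`. -/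
def IsMPrimeSubmodule (M : Type*) [AddCommGroup M] [Module R M]
    (X : Type*) [AddCommGroup X] [Module R X] (P : Submodule R X) : Prop :=
  P ≠ ⊤ ∧ ∀ (N : Submodule R M) (Y : Submodule R X),
    bprodSub R M X N Y ≤ P → bprod R M X N ≤ P ∨ Y ≤ P

/-- `X` is an `M`-prime module if `X ≠ 0` and `(0)` is an `M`-prime submodule of `X`. -/
def IsMPrimeModule (M : Type*) [AddCommGroup M] [Module R M]
    (X : Type*) [AddCommGroup X] [Module R X] : Prop :=
  IsMPrimeSubmodule R M X (⊥ : Submodule R X)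

/-- A proper submodule `P` of `X` is `M`-semiprime if `N²·Y ⊆ P` implies `N·Y ⊆ P`. -/
def IsMSemiprimeSubmodule (M : Type*) [AddCommGroup M] [Module R M]
    (X : Type*) [AddCommGroup X] [Module R X] (P : Submodule R X) : Prop :=
  P ≠ ⊤ ∧ ∀ (N : Submodule R M) (Y : Submodule R X),
    bprodSub R M X (msq R M N) Y ≤ P → bprodSub R M X N Y ≤ P

/-- `X` is an `M`-semiprime module if `X ≠ 0` and `(0)` is an `M`-semiprime submodule. -/
def IsMSemiprimeModule (M : Type*) [AddCommGroup M] [Module R M]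
    (X : Type*) [AddCommGroup X] [Module R X] : Prop :=
  IsMSemiprimeSubmodule R M X (⊥ : Submodule R X)

/-- A submodule `N` of `M` is an `M`-ideal if `N = Ann_M(M/N)`. -/
def IsMIdeal (M : Type*) [AddCommGroup M] [Module R M] (N : Submodule R M) : Prop :=
  N = annM R M (M ⧸ N)

/-- The `M`-prime radical `rad_M(X)`: the intersection of all `M`-prime submodules of `X`
(which is all of `X` when there are none). -/
def radM (M : Type*) [AddCommGroup M] [Module R M]
    (X : Type*) [AddCommGroup X] [Module R X] : Submodule R X :=
  sInf {P : Submodule R X | IsMPrimeSubmodule R M X P}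

/-- An `M`-m-system in `X`. -/
def IsMmSystem (M : Type*) [AddCommGroup M] [Module R M]
    (X : Type*) [AddCommGroup X] [Module R X] (S : Set X) : Prop :=
  S.Nonempty ∧ (0 : X) ∉ S ∧
    ∀ (N : Submodule R M) (Y Z : Submodule R X),
      ((↑(Y ⊔ Z) : Set X) ∩ S).Nonempty →
      ((↑(Y ⊔ bprod R M X N) : Set X) ∩ S).Nonempty →
      ((↑(Y ⊔ bprodSub R M X N Z) : Set X) ∩ S).Nonempty

/-- An `M`-n-system in `X`. -/
def IsMnSystem (M : Type*) [AddCommGroup M] [Module R M]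
    (X : Type*) [AddCommGroup X] [Module R X] (T : Set X) : Prop :=
  T.Nonempty ∧ (0 : X) ∉ T ∧
    ∀ (N : Submodule R M) (Y Z : Submodule R X),
      ((↑(Y ⊔ bprodSub R M X N Z) : Set X) ∩ T).Nonempty →
      ((↑(Y ⊔ bprodSub R M X (msq R M N) Z) : Set X) ∩ T).Nonempty

variable (M : Type v) [AddCommGroup M] [Module R M]

/-- A proper `M`-ideal `P` is a prime `M`-ideal if `P = Ann_M(X)` for some `M`-prime module. -/
def IsPrimeMIdeal (P : Submodule R M) : Prop :=
  IsMIdeal R M P ∧ P ≠ ⊤ ∧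
    ∃ (X : Type v) (_ : AddCommGroup X) (_ : Module R X),
      IsMPrimeModule R M X ∧ P = annM R M X

/-- `X` is Beachy-`M`-prime if `Hom_R(M,X) ≠ 0` and `Ann_M(Y) = Ann_M(X)` for every
submodule `Y ⊆ X` with `Hom_R(M,Y) ≠ 0`. -/
def IsBeachyMPrimeModule (X : Type v) [AddCommGroup X] [Module R X] : Prop :=
  (∃ f : M →ₗ[R] X, f ≠ 0) ∧
    ∀ Y : Submodule R X, (∃ g : M →ₗ[R] ↥Y, g ≠ 0) → annM R M (↥Y) = annM R M X

/-- A proper `M`-ideal `P` is a Beachy-prime `M`-ideal if `P = Ann_M(X)` for some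
Beachy-`M`-prime module `X`. -/
def IsBeachyPrimeMIdeal (P : Submodule R M) : Prop :=
  IsMIdeal R M P ∧ P ≠ ⊤ ∧
    ∃ (X : Type v) (_ : AddCommGroup X) (_ : Module R X),
      IsBeachyMPrimeModule R M X ∧ P = annM R M X

/-- An `M`-ideal `P` is primitive if `P = Ann_M(S)` for some simple module `S`. -/
def IsPrimitiveMIdeal (P : Submodule R M) : Prop :=
  IsMIdeal R M P ∧
    ∃ (S : Type v) (_ : AddCommGroup S) (_ : Module R S),
      IsSimpleModule R S ∧ P = annM R M S

/-- The prime radical `P(M)`: the intersection of all prime `M`-ideals of `M`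
(all of `M` when there are none). -/
def primeRadM : Submodule R M := sInf {P : Submodule R M | IsPrimeMIdeal R M P}

/-- `X` belongs to `σ[M]`: `X` embeds in a quotient of a direct sum of copies of `M`. -/
def MemSigma (X : Type v) [AddCommGroup X] [Module R X] : Prop :=
  ∃ (ι : Type v) (K : Submodule R (ι →₀ M)) (g : X →ₗ[R] (ι →₀ M) ⧸ K),
    Function.Injective g

/-- `M` is projective in `σ[M]`. -/
def IsProjInSigma : Prop :=
  ∀ (A : Type v) [AddCommGroup A] [Module R A] (B : Type v) [AddCommGroup B] [Module R B],
    MemSigma R M A → MemSigma R M B →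
      ∀ (g : A →ₗ[R] B), Function.Surjective g →
        ∀ f : M →ₗ[R] B, ∃ h : M →ₗ[R] A, g.comp h = f

/-- `X` is a homogeneous semisimple module: a direct sum of mutually isomorphic
simple modules. -/
def IsHomogSemisimple (X : Type v) [AddCommGroup X] [Module R X] : Prop :=
  ∃ (S : Type v) (_ : AddCommGroup S) (_ : Module R S) (ι : Type v),
    IsSimpleModule R S ∧ Nonempty (X ≃ₗ[R] (ι →₀ S))

end BeachyDefs

theorem aux_map_bot {R : Type*} [Ring R] {X : Type*} [AddCommGroup X] [Module R X]
    {Y : Type*} [AddCommGroup Y] [Module R Y] (f : X →ₗ[R] Y) (hf : Function.Injective f)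
    {p : Submodule R X} : p.map f = ⊥ ↔ p = ⊥ := by
  constructor
  · intro h
    apply Submodule.map_injective_of_injective hf
    rw [h, Submodule.map_bot]
  · rintro rfl
    exact Submodule.map_bot f

theorem aux_mem_annM (R : Type*) [Ring R] (M : Type*) [AddCommGroup M] [Module R M]
    (X : Type*) [AddCommGroup X] [Module R X] (m : M) :
    m ∈ annM R M X ↔ ∀ f : M →ₗ[R] X, f m = 0 := by
  simp [annM, Submodule.mem_iInf]

theorem aux_annM_anti (R : Type*) [Ring R] (M : Type*) [AddCommGroup M] [Module R M]
    {X : Type*} [AddCommGroup X] [Module R X] {Y : Type*} [AddCommGroup Y] [Module R Y]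
    (g : X →ₗ[R] Y) (hg : Function.Injective g) : annM R M Y ≤ annM R M X := by
  intro m hm
  rw [aux_mem_annM] at hm ⊢
  intro f
  apply hg
  rw [map_zero]
  exact hm (g.comp f)

theorem aux_bprod (R : Type*) [Ring R] (M : Type*) [AddCommGroup M] [Module R M]
    (X : Type*) [AddCommGroup X] [Module R X] (N : Submodule R M) :
    bprod R M X N = ⊥ ↔ N ≤ annM R M X := by
  constructor
  · intro h n hn
    rw [aux_mem_annM]
    intro f
    rw [← Submodule.mem_bot R, ← h, bprod, Submodule.mem_sInf]
    intro Y hY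
    have := hY (Y.mkQ.comp f) n hn
    simpa using this
  · intro h
    rw [eq_bot_iff]
    apply sInf_le
    intro f n hn
    have h1 := (aux_mem_annM R M X n).1 (h hn)
      ((Submodule.quotEquivOfEqBot (⊥ : Submodule R X) rfl).toLinearMap.comp f)
    simpa using h1

theorem aux_bprodSub (R : Type*) [Ring R] (M : Type*) [AddCommGroup M] [Module R M]
    (X : Type*) [AddCommGroup X] [Module R X] (N : Submodule R M) (Y : Submodule R X) :
    bprodSub R M X N Y = ⊥ ↔ N ≤ annM R M Y := by
  rw [← aux_bprod, bprodSub, aux_map_bot _ Y.injective_subtype]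

theorem aux_mIdeal (R : Type*) [Ring R] (M : Type*) [AddCommGroup M] [Module R M]
    (X : Type*) [AddCommGroup X] [Module R X] : IsMIdeal R M (annM R M X) := by
  apply le_antisymm
  · intro n hn
    rw [aux_mem_annM] at hn ⊢
    intro g
    obtain ⟨m, hm⟩ := Submodule.mkQ_surjective _ (g n)
    rw [← hm]
    rw [Submodule.mkQ_apply, Submodule.Quotient.mk_eq_zero, aux_mem_annM]
    intro f
    have hf : annM R M X ≤ LinearMap.ker f := fun x hx => (aux_mem_annM R M X x).1 hx f
    have := hn (((annM R M X).liftQ f hf).comp g)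
    rw [LinearMap.comp_apply, ← hm] at this
    simpa using this
  · intro n hn
    rw [aux_mem_annM] at hn
    simpa using hn (annM R M X).mkQ

theorem aux_prime (R : Type*) [Ring R] (M : Type*) [AddCommGroup M] [Module R M]
    (X : Type*) [AddCommGroup X] [Module R X] (hX : Nontrivial X) :
    IsMPrimeModule R M X ↔ ∀ Y : Submodule R X, Y ≠ ⊥ → annM R M Y ≤ annM R M X := by
  unfold IsMPrimeModule IsMPrimeSubmodule
  simp only [le_bot_iff, aux_bprod, aux_bprodSub]
  constructor
  · rintro ⟨-, h⟩ Y hY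
    exact (h _ Y le_rfl).resolve_right hY
  · intro h
    refine ⟨bot_ne_top, fun N Y hN => ?_⟩
    by_cases hY : Y = ⊥
    · exact Or.inr hY
    · exact Or.inl (hN.trans (h Y hY))

/-- Proposition 2.4: characterizations of `M`-prime modules. -/
theorem isMPrimeModule_tfae (R : Type u) [Ring R] (M : Type v) [AddCommGroup M] [Module R M]
    (X : Type v) [AddCommGroup X] [Module R X] (hX : Nontrivial X) :
    (IsMPrimeModule R M X ↔
      ∀ (N : Submodule R M) (Y : Submodule R X), Y ≠ ⊥ →
        bprodSub R M X N Y = ⊥ → bprod R M X N = ⊥) ∧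
    (IsMPrimeModule R M X ↔
      ∀ N : Submodule R M, IsMIdeal R M N → ∀ Y : Submodule R X, Y ≠ ⊥ →
        bprodSub R M X N Y = ⊥ → bprod R M X N = ⊥) ∧
    (IsMPrimeModule R M X ↔
      ∀ Y₁ Y₂ : Submodule R X, Y₁ ≠ ⊥ → Y₂ ≠ ⊥ →
        annM R M (↥Y₁) = annM R M (↥Y₂)) ∧
    (IsMPrimeModule R M X ↔
      ∀ Y : Submodule R X, Y ≠ ⊥ → IsMPrimeModule R M (↥Y)) := by
  rw [aux_prime R M X hX]
  simp only [aux_bprod, aux_bprodSub]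
  refine ⟨⟨fun h N Y hY hN => hN.trans (h Y hY), fun h Y hY => h _ Y hY le_rfl⟩,
    ⟨fun h N _ Y hY hN => hN.trans (h Y hY), fun h Y hY => h _ (aux_mIdeal R M Y) Y hY le_rfl⟩,
    ⟨fun h Y₁ Y₂ h₁ h₂ => ?_, fun h Y hY => ?_⟩, ⟨fun h Y hY => ?_, fun h => ?_⟩⟩
  · exact le_antisymm ((h Y₁ h₁).trans (aux_annM_anti R M Y₂.subtype Y₂.injective_subtype))
      ((h Y₂ h₂).trans (aux_annM_anti R M Y₁.subtype Y₁.injective_subtype))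
  · rw [h Y ⊤ hY top_ne_bot]
    exact aux_annM_anti R M (Submodule.topEquiv (R := R) (M := X)).symm.toLinearMap
      (Submodule.topEquiv (R := R) (M := X)).symm.injective
  · rw [aux_prime R M Y (Submodule.nontrivial_iff_ne_bot.2 hY)]
    intro Z hZ
    have hZ' : Z.map Y.subtype ≠ ⊥ := fun h0 =>
      hZ ((aux_map_bot _ Y.injective_subtype).1 h0)
    have e := Submodule.equivMapOfInjective Y.subtype Y.injective_subtype Z
    exact (aux_annM_anti R M e.symm.toLinearMap e.symm.injective).trans
      ((h _ hZ').trans (aux_annM_anti R M Y.subtype Y.injective_subtype))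
  · intro Y hY
    have e := (Submodule.topEquiv (R := R) (M := X))
    have hT := (aux_prime R M (⊤ : Submodule R X) e.toEquiv.nontrivial).1 (h ⊤ top_ne_bot)
    have hZ' : Y.map e.symm.toLinearMap ≠ ⊥ := fun h0 =>
      hY ((aux_map_bot _ e.symm.injective).1 h0)
    have e' := Submodule.equivMapOfInjective e.symm.toLinearMap e.symm.injective Y
    exact (aux_annM_anti R M e'.symm.toLinearMap e'.symm.injective).trans
      ((hT _ hZ').trans (aux_annM_anti R M e.symm.toLinearMap e.symm.injective))
end

section
/- Let X be an R-module such that Hom_R(M,X) ≠ 0, i.e., there exists a nonzero R-homomorphism M → X. If X is an M-prime module, then X is a Beachy-M-prime module, i.e., Ann_M(Y) = Ann_M(X) for every submodule Y of X with Hom_R(M,Y) ≠ 0. -/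
universe u v

/-- Proposition 2.7: if `Hom_R(M,X) ≠ 0` and `X` is `M`-prime, then `X` is
Beachy-`M`-prime. -/
theorem isBeachyMPrime_of_isMPrime (R : Type u) [Ring R]
    (M : Type v) [AddCommGroup M] [Module R M]
    (X : Type v) [AddCommGroup X] [Module R X]
    (hhom : ∃ f : M →ₗ[R] X, f ≠ 0) (hprime : IsMPrimeModule R M X) :
    ∀ Y : Submodule R X, (∃ g : M →ₗ[R] ↥Y, g ≠ 0) → annM R M (↥Y) = annM R M X := by
  intro Y ⟨g, hg⟩
  apply le_antisymm
  · have key : bprodSub R M X (annM R M (↥Y)) Y ≤ ⊥ := by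
      unfold bprodSub
      rw [Submodule.map_le_iff_le_comap]
      have h0 : bprod R M (↥Y) (annM R M (↥Y)) ≤ ⊥ := by
        apply sInf_le
        intro f n hn
        have h1 := (Submodule.mem_iInf _).1 hn
          ((Submodule.quotEquivOfEqBot (⊥ : Submodule R (↥Y)) rfl).toLinearMap.comp f)
        simpa using h1
      exact h0.trans bot_le
    rcases hprime.2 _ _ key with h | h
    · intro n hn
      refine (Submodule.mem_iInf _).2 fun f => ?_
      have h2 : f n ∈ bprod R M X (annM R M (↥Y)) := by
        refine (Submodule.mem_sInf).2 fun Z hZ => ?_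
        have h3 := hZ (Z.mkQ.comp f) n hn
        simpa using h3
      simpa using h h2
    · exfalso
      apply hg
      ext m
      simpa using h (g m).2
  · intro n hn
    refine (Submodule.mem_iInf _).2 fun f => ?_
    have h1 := (Submodule.mem_iInf _).1 hn (Y.subtype.comp f)
    simpa using h1
end

section
/- Assume M is projective in σ[M] and let X be a module in σ[M]. If P is an M-prime submodule of X, then the quotient module X/P is an M-prime module. -/
universe u v

theorem mem_bprod_of_hom (R : Type u) [Ring R]
    {M : Type*} [AddCommGroup M] [Module R M] {X : Type*} [AddCommGroup X] [Module R X]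
    (N : Submodule R M) (f : M →ₗ[R] X) {n : M} (hn : n ∈ N) : f n ∈ bprod R M X N := by
  unfold bprod
  rw [Submodule.mem_sInf]
  intro Y hY
  have := hY (Y.mkQ.comp f) n hn
  simpa using this

theorem memSigma_quotient (R : Type u) [Ring R]
    (M : Type v) [AddCommGroup M] [Module R M]
    (X : Type v) [AddCommGroup X] [Module R X] (hX : MemSigma R M X)
    (P : Submodule R X) : MemSigma R M (X ⧸ P) := by
  obtain ⟨ι, K, g, hg⟩ := hX
  let L : Submodule R ((ι →₀ M) ⧸ K) := P.map g
  let q : (ι →₀ M) →ₗ[R] ((ι →₀ M) ⧸ K) ⧸ L := L.mkQ.comp K.mkQ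
  have hq : Function.Surjective q := L.mkQ_surjective.comp K.mkQ_surjective
  have hker : P ≤ LinearMap.ker (L.mkQ.comp g) := by
    intro x hx
    exact (Submodule.Quotient.mk_eq_zero L).2 (Submodule.mem_map_of_mem hx)
  refine ⟨ι, LinearMap.ker q,
    (q.quotKerEquivOfSurjective hq).symm.toLinearMap.comp (P.liftQ (L.mkQ.comp g) hker), ?_⟩
  rw [LinearMap.coe_comp]
  refine (q.quotKerEquivOfSurjective hq).symm.injective.comp ?_
  rw [← LinearMap.ker_eq_bot, Submodule.ker_liftQ_eq_bot]
  intro x hx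
  have h1 : g x ∈ L := by simpa using hx
  obtain ⟨y, hy, hxy⟩ := h1
  exact hg hxy ▸ hy

/-- Proposition 2.10(i): if `M` is projective in `σ[M]`, `X ∈ σ[M]` and `P` is
an `M`-prime submodule of `X`, then `X/P` is an `M`-prime module. -/
theorem isMPrimeModule_quotient (R : Type u) [Ring R]
    (M : Type v) [AddCommGroup M] [Module R M] (hproj : IsProjInSigma R M)
    (X : Type v) [AddCommGroup X] [Module R X] (hX : MemSigma R M X)
    (P : Submodule R X) (hP : IsMPrimeSubmodule R M X P) :
    IsMPrimeModule R M (X ⧸ P) := by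
  refine ⟨?_, ?_⟩
  · intro h
    apply hP.1
    rw [eq_top_iff]
    intro x _
    have : P.mkQ x ∈ (⊥ : Submodule R (X ⧸ P)) := h ▸ Submodule.mem_top
    simpa using this
  intro N Z hZ
  have key : bprodSub R M X N (Z.comap P.mkQ) ≤ P := by
    unfold bprodSub
    rw [Submodule.map_le_iff_le_comap]
    refine sInf_le ?_
    intro f n hn
    let r : ↥(Z.comap P.mkQ) →ₗ[R] Z :=
      (P.mkQ.comp (Z.comap P.mkQ).subtype).codRestrict Z (fun y => y.2)
    have hr : P.comap (Z.comap P.mkQ).subtype ≤ LinearMap.ker r := by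
      intro y hy
      rw [LinearMap.mem_ker]
      apply Subtype.ext
      exact (Submodule.Quotient.mk_eq_zero P).2 hy
    have h0 := mem_bprod_of_hom R N ((Submodule.liftQ _ r hr).comp f) hn
    have h1 := hZ (Submodule.mem_map_of_mem h0)
    obtain ⟨y, hy⟩ := Submodule.mkQ_surjective _ (f n)
    rw [LinearMap.comp_apply, ← hy, Submodule.mkQ_apply, Submodule.liftQ_apply] at h1
    rw [← hy, Submodule.mkQ_apply, Submodule.Quotient.mk_eq_zero]
    exact (Submodule.Quotient.mk_eq_zero P).1 h1
  rcases hP.2 N _ key with h | h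
  · left
    refine sInf_le ?_
    intro f n hn
    have hQ := memSigma_quotient R M X hX P
    obtain ⟨h', hh⟩ := hproj X ((X ⧸ P) ⧸ (⊥ : Submodule R (X ⧸ P))) hX
      (memSigma_quotient R M _ hQ _)
      ((Submodule.mkQ ⊥).comp P.mkQ)
      ((Submodule.mkQ_surjective _).comp (Submodule.mkQ_surjective _)) f
    have h2 : h' n ∈ P := h (mem_bprod_of_hom R N h' hn)
    rw [← hh]
    have h3 : P.mkQ (h' n) = 0 := (Submodule.Quotient.mk_eq_zero P).2 h2
    rw [LinearMap.comp_apply, LinearMap.comp_apply, h3, map_zero]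
  · right
    intro z hz
    obtain ⟨x, rfl⟩ := P.mkQ_surjective z
    exact (Submodule.Quotient.mk_eq_zero P).2 (h hz)
end

section
/- Assume M is projective in σ[M] and let P be a proper M-ideal of M. The following are equivalent: (1) P is a prime M-ideal; (2) P is an M-prime submodule of the module M; (3) M/P is an M-prime module. -/
universe u v

section Helpers

variable {R : Type u} [Ring R]

lemma mem_annM_iff {M : Type*} [AddCommGroup M] [Module R M]
    {X : Type*} [AddCommGroup X] [Module R X] (m : M) :
    m ∈ annM R M X ↔ ∀ f : M →ₗ[R] X, f m = 0 := by
  simp [annM]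

lemma map_mem_bprod {M : Type*} [AddCommGroup M] [Module R M]
    {X : Type*} [AddCommGroup X] [Module R X] (N : Submodule R M) (f : M →ₗ[R] X)
    {n : M} (hn : n ∈ N) : f n ∈ bprod R M X N := by
  rw [bprod, Submodule.mem_sInf]
  intro Y hY
  have := hY (Y.mkQ.comp f) n hn
  simpa using this

lemma bprod_le_ker {M : Type*} [AddCommGroup M] [Module R M]
    {X : Type*} [AddCommGroup X] [Module R X] {B : Type*} [AddCommGroup B] [Module R B]
    (N : Submodule R M) (p : X →ₗ[R] B) (h : N ≤ annM R M B) :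
    bprod R M X N ≤ LinearMap.ker p := by
  refine sInf_le ?_
  intro f n hn
  have h1 := (mem_annM_iff n).1 (h hn)
    (((LinearMap.range p).subtype.comp p.quotKerEquivRange.toLinearMap).comp f)
  simpa using h1

lemma bprod_le_bot_iff {M : Type*} [AddCommGroup M] [Module R M]
    {X : Type*} [AddCommGroup X] [Module R X] (N : Submodule R M) :
    bprod R M X N ≤ ⊥ ↔ N ≤ annM R M X := by
  constructor
  · intro h n hn
    rw [mem_annM_iff]
    intro f
    simpa using h (map_mem_bprod N f hn)
  · intro h
    simpa using bprod_le_ker N (LinearMap.id : X →ₗ[R] X) h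

lemma bprodSub_le_iff {M : Type*} [AddCommGroup M] [Module R M]
    {X : Type*} [AddCommGroup X] [Module R X] (N : Submodule R M) (Y P : Submodule R X) :
    bprodSub R M X N Y ≤ P ↔ bprod R M Y N ≤ P.comap Y.subtype :=
  Submodule.map_le_iff_le_comap

lemma isMPrimeModule_iff {M : Type*} [AddCommGroup M] [Module R M]
    {X : Type*} [AddCommGroup X] [Module R X] :
    IsMPrimeModule R M X ↔ (⊥ : Submodule R X) ≠ ⊤ ∧
      ∀ Y : Submodule R X, Y ≠ ⊥ → annM R M Y ≤ annM R M X := by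
  have key : ∀ (N : Submodule R M) (Y : Submodule R X),
      bprodSub R M X N Y ≤ ⊥ ↔ N ≤ annM R M Y := by
    intro N Y
    rw [bprodSub_le_iff, ← bprod_le_bot_iff, Submodule.comap_bot, Submodule.ker_subtype]
  unfold IsMPrimeModule IsMPrimeSubmodule
  refine and_congr_right fun _ => ?_
  constructor
  · intro h Y hY
    rcases h _ Y ((key _ Y).2 le_rfl) with h1 | h1
    · exact (bprod_le_bot_iff _).1 h1
    · exact absurd (le_bot_iff.1 h1) hY
  · intro h N Y hNY
    by_cases hY : Y = ⊥
    · exact Or.inr hY.le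
    · exact Or.inl ((bprod_le_bot_iff _).2 (((key _ _).1 hNY).trans (h Y hY)))

variable {M : Type v} [AddCommGroup M] [Module R M]

lemma memSigma_of_le_range {X : Type v} [AddCommGroup X] [Module R X] (f : M →ₗ[R] X)
    (Y : Submodule R X) (hY : Y ≤ LinearMap.range f) : MemSigma R M Y := by
  let F : (PUnit.{v+1} →₀ M) →ₗ[R] X := f.comp (Finsupp.lapply PUnit.unit)
  have hF : Y ≤ LinearMap.range F := by
    intro y hy
    obtain ⟨m, rfl⟩ := hY hy
    exact ⟨Finsupp.single PUnit.unit m, by simp [F]⟩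
  refine ⟨PUnit, LinearMap.ker F,
    F.quotKerEquivRange.symm.toLinearMap.comp (Submodule.inclusion hF), ?_⟩
  exact F.quotKerEquivRange.symm.injective.comp (Submodule.inclusion_injective hF)

/-- lifting along the surjection from `Z` onto its image under `p`. -/
lemma annM_le_annM_map (hproj : IsProjInSigma R M) {A X : Type v} [AddCommGroup A] [Module R A]
    [AddCommGroup X] [Module R X] (q : M →ₗ[R] A) (hq : Function.Surjective q)
    (p : A →ₗ[R] X) (Z : Submodule R A) (g : M →ₗ[R] (Z.map p : Submodule R X)) :
    ∃ h : M →ₗ[R] Z, ∀ m, p (h m) = g m := by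
  have hZ : MemSigma R M Z := memSigma_of_le_range q Z (by
    rw [LinearMap.range_eq_top.2 hq]; exact le_top)
  have hB : MemSigma R M (Z.map p : Submodule R X) := memSigma_of_le_range (p.comp q) _ (by
    rintro _ ⟨z, _, rfl⟩
    obtain ⟨m, rfl⟩ := hq z
    exact ⟨m, rfl⟩)
  obtain ⟨h, hh⟩ := hproj _ _ hZ hB (p.submoduleMap Z) (p.submoduleMap_surjective Z) g
  refine ⟨h, fun m => ?_⟩
  rw [← hh]
  rfl

lemma prime_iff_module (hproj : IsProjInSigma R M)
    (P : Submodule R M) (hid : IsMIdeal R M P) (hne : P ≠ ⊤) :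
    IsPrimeMIdeal R M P ↔ IsMPrimeModule R M (M ⧸ P) := by
  constructor
  · rintro ⟨-, -, X, _, _, hX, hP⟩
    rw [isMPrimeModule_iff] at hX ⊢
    refine ⟨?_, ?_⟩
    · intro h
      apply hne
      rw [eq_top_iff]
      intro m _
      have : P.mkQ m ∈ (⊥ : Submodule R (M ⧸ P)) := by rw [h]; trivial
      simpa using this
    · intro Z hZ
      rw [← hid]
      obtain ⟨z, hz, hz0⟩ := (Submodule.ne_bot_iff Z).1 hZ
      obtain ⟨m, rfl⟩ := P.mkQ_surjective z
      have hm : m ∉ P := by simpa using hz0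
      rw [hP, mem_annM_iff] at hm
      push Not at hm
      obtain ⟨f, hf⟩ := hm
      have hPf : P ≤ LinearMap.ker f := by
        intro x hx
        rw [hP, mem_annM_iff] at hx
        exact hx f
      have hY : Z.map (P.liftQ f hPf) ≠ ⊥ := by
        rw [Submodule.ne_bot_iff]
        exact ⟨_, ⟨_, hz, rfl⟩, by simpa using hf⟩
      refine le_trans ?_ ((hX.2 _ hY).trans hP.ge)
      intro n hn
      rw [mem_annM_iff] at hn ⊢
      intro g
      obtain ⟨h, hh⟩ := annM_le_annM_map hproj P.mkQ P.mkQ_surjective _ Z g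
      apply Subtype.ext
      rw [← hh, hn h]
      simp
  · intro h
    exact ⟨hid, hne, M ⧸ P, inferInstance, inferInstance, h, hid⟩

lemma submodule_iff_module (hproj : IsProjInSigma R M)
    (P : Submodule R M) (hid : IsMIdeal R M P) (hne : P ≠ ⊤) :
    IsMPrimeSubmodule R M M P ↔ IsMPrimeModule R M (M ⧸ P) := by
  have key1 : ∀ N : Submodule R M, bprod R M M N ≤ P ↔ N ≤ P := by
    intro N
    constructor
    · intro h n hn
      exact h (map_mem_bprod N LinearMap.id hn)
    · intro h
      have h2 : N ≤ annM R M (M ⧸ P) := h.trans hid.le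
      simpa using bprod_le_ker N P.mkQ h2
  have key2 : ∀ N Y : Submodule R M, bprodSub R M M N Y ≤ P ↔
      N ≤ annM R M (Y.map P.mkQ : Submodule R (M ⧸ P)) := by
    intro N Y
    rw [bprodSub_le_iff]
    constructor
    · intro h n hn
      rw [mem_annM_iff]
      intro g
      obtain ⟨k, hk⟩ := annM_le_annM_map hproj LinearMap.id Function.surjective_id P.mkQ Y g
      have h1 : ((k n : Y) : M) ∈ P := h (map_mem_bprod N k hn)
      apply Subtype.ext
      rw [← hk]
      simpa using h1
    · intro h y hy
      have h1 := bprod_le_ker N (P.mkQ.submoduleMap Y) h hy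
      have h2 : P.mkQ (y : M) = 0 := congrArg Subtype.val (LinearMap.mem_ker.1 h1)
      simpa using h2
  rw [isMPrimeModule_iff]
  unfold IsMPrimeSubmodule
  have hbot : (⊥ : Submodule R (M ⧸ P)) ≠ ⊤ := by
    intro h
    apply hne
    rw [eq_top_iff]
    intro m _
    have : P.mkQ m ∈ (⊥ : Submodule R (M ⧸ P)) := by rw [h]; trivial
    simpa using this
  rw [← hid]
  constructor
  · rintro ⟨-, h⟩
    refine ⟨hbot, fun Z hZ => ?_⟩
    have hmap : (Z.comap P.mkQ).map P.mkQ = Z :=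
      Submodule.map_comap_eq_of_surjective P.mkQ_surjective Z
    rcases h (annM R M Z) (Z.comap P.mkQ) ((key2 _ _).2 (by rw [hmap])) with h1 | h1
    · exact (key1 _).1 h1
    · exfalso
      apply hZ
      rw [← hmap, eq_bot_iff, Submodule.map_le_iff_le_comap]
      simpa using h1
  · rintro ⟨-, h⟩
    refine ⟨hne, fun N Y hNY => ?_⟩
    by_cases hY : Y.map P.mkQ = ⊥
    · right
      rw [eq_bot_iff, Submodule.map_le_iff_le_comap] at hY
      simpa using hY
    · left
      exact (key1 _).2 (((key2 _ _).1 hNY).trans (h _ hY))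

end Helpers

/-- Proposition 2.10(ii): for `M` projective in `σ[M]` and a proper `M`-ideal
`P`, the conditions "prime `M`-ideal", "`M`-prime submodule of `M`" and "`M/P` is an
`M`-prime module" are equivalent. -/
theorem isPrimeMIdeal_tfae (R : Type u) [Ring R]
    (M : Type v) [AddCommGroup M] [Module R M] (hproj : IsProjInSigma R M)
    (P : Submodule R M) (hid : IsMIdeal R M P) (hne : P ≠ ⊤) :
    (IsPrimeMIdeal R M P ↔ IsMPrimeSubmodule R M M P) ∧
    (IsPrimeMIdeal R M P ↔ IsMPrimeModule R M (M ⧸ P)) := by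
  have h1 := prime_iff_module hproj P hid hne
  exact ⟨h1.trans (submodule_iff_module hproj P hid hne).symm, h1⟩
end

section
/- Let X be an R-module, P a proper submodule of X, and S := X∖P. The following are equivalent: (1) P is an M-prime submodule of X; (2) S is an M-m-system; (3) for every submodule N of M and every submodule Z of X, if Z∩S ≠ ∅ and (N·X)∩S ≠ ∅, then (N·Z)∩S ≠ ∅. -/
universe u v

/-- Proposition 2.14: for a proper submodule `P` of `X` and `S := X∖P`,
`P` is `M`-prime iff `S` is an `M`-m-system iff condition (3). -/
theorem isMPrimeSubmodule_iff_mSystem (R : Type u) [Ring R]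
    (M : Type v) [AddCommGroup M] [Module R M]
    (X : Type v) [AddCommGroup X] [Module R X]
    (P : Submodule R X) (hP : P ≠ ⊤) :
    (IsMPrimeSubmodule R M X P ↔ IsMmSystem R M X ((P : Set X)ᶜ)) ∧
    (IsMPrimeSubmodule R M X P ↔
      ∀ (N : Submodule R M) (Z : Submodule R X),
        ((Z : Set X) ∩ (P : Set X)ᶜ).Nonempty →
        ((bprod R M X N : Set X) ∩ (P : Set X)ᶜ).Nonempty →
        ((bprodSub R M X N Z : Set X) ∩ (P : Set X)ᶜ).Nonempty) := by
  have key : ∀ A : Submodule R X, ((A : Set X) ∩ (P : Set X)ᶜ).Nonempty ↔ ¬ A ≤ P := by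
    intro A
    rw [Set.inter_compl_nonempty_iff, SetLike.coe_subset_coe]
  have h13 : IsMPrimeSubmodule R M X P ↔
      ∀ (N : Submodule R M) (Z : Submodule R X),
        ¬ Z ≤ P → ¬ bprod R M X N ≤ P → ¬ bprodSub R M X N Z ≤ P := by
    constructor
    · intro h N Z hZ hN hle
      rcases h.2 N Z hle with h1 | h1
      · exact hN h1
      · exact hZ h1
    · intro h
      refine ⟨hP, fun N Y hle => ?_⟩
      by_contra hc
      rw [not_or] at hc
      exact h N Y hc.2 hc.1 hle
  refine ⟨?_, by simpa only [key] using h13⟩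
  unfold IsMmSystem
  simp only [key]
  constructor
  · intro h
    refine ⟨?_, fun h0 => h0 P.zero_mem, ?_⟩
    · by_contra hne
      rw [Set.not_nonempty_iff_eq_empty, Set.compl_empty_iff] at hne
      exact hP (SetLike.coe_injective hne)
    · intro N Y Z h1 h2 h3
      rw [sup_le_iff] at h1 h2 h3
      exact h13.1 h N Z (fun h => h1 ⟨h3.1, h⟩) (fun h => h2 ⟨h3.1, h⟩) h3.2
  · rintro ⟨-, -, h⟩
    refine h13.2 fun N Z hZ hN => ?_
    have := h N ⊥ Z
    simp only [bot_sup_eq] at this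
    exact this hZ hN
end

section
/- Let X be an R-module, let S ⊆ X be an M-m-system, and let P be a submodule of X maximal with respect to the property that P is disjoint from S (i.e., P∩S = ∅ and every submodule of X strictly containing P meets S). Then P is an M-prime submodule of X. -/
universe u v

/-- Proposition 2.15: a submodule maximal with respect to being disjoint from
an `M`-m-system `S` is an `M`-prime submodule. -/
theorem isMPrimeSubmodule_of_maximal_disjoint (R : Type u) [Ring R]
    (M : Type v) [AddCommGroup M] [Module R M]
    (X : Type v) [AddCommGroup X] [Module R X]
    (S : Set X) (hS : IsMmSystem R M X S) (P : Submodule R X)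
    (hdisj : (P : Set X) ∩ S = ∅)
    (hmax : ∀ Q : Submodule R X, P < Q → ((Q : Set X) ∩ S).Nonempty) :
    IsMPrimeSubmodule R M X P := by
  obtain ⟨hne, _, hsys⟩ := hS
  refine ⟨?_, fun N Y hNY => ?_⟩
  · rintro rfl
    obtain ⟨x, hx⟩ := hne
    have hmem : x ∈ ((⊤ : Submodule R X) : Set X) ∩ S := ⟨Submodule.mem_top, hx⟩
    rw [hdisj] at hmem
    exact hmem
  · by_contra hcon
    rw [not_or] at hcon
    obtain ⟨h1, h2⟩ := hcon
    have key := hsys N P Y (hmax _ (left_lt_sup.2 h2)) (hmax _ (left_lt_sup.2 h1))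
    rw [sup_eq_left.2 hNY, hdisj] at key
    exact Set.not_nonempty_empty key
end

section
/- Let X be an R-module and Y a submodule of X such that at least one M-prime submodule of X contains Y. Then the set √[M]{Y} := {x ∈ X : every M-m-system containing x meets Y} equals the intersection of all M-prime submodules of X containing Y. -/
universe u v

/-- Theorem 2.17: if some `M`-prime submodule of `X` contains `Y`, then
`√[M]{Y}` equals the intersection of all `M`-prime submodules of `X` containing `Y`. -/
theorem sqrtM_eq_sInf (R : Type u) [Ring R]
    (M : Type v) [AddCommGroup M] [Module R M]
    (X : Type v) [AddCommGroup X] [Module R X] (Y : Submodule R X)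
    (h : ∃ P : Submodule R X, IsMPrimeSubmodule R M X P ∧ Y ≤ P) :
    {x : X | ∀ S : Set X, IsMmSystem R M X S → x ∈ S → (S ∩ (Y : Set X)).Nonempty} =
      ↑(sInf {P : Submodule R X | IsMPrimeSubmodule R M X P ∧ Y ≤ P}) := by
  ext x
  simp only [Set.mem_setOf_eq, SetLike.mem_coe, Submodule.mem_sInf]
  constructor
  · rintro hx P ⟨⟨hP, hprime⟩, hYP⟩
    by_contra hxP
    have key : ∀ A : Submodule R X, ((A : Set X) ∩ (P : Set X)ᶜ).Nonempty ↔ ¬ A ≤ P := by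
      intro A
      rw [SetLike.not_le_iff_exists]
      constructor
      · rintro ⟨a, ha, hb⟩
        exact ⟨a, ha, hb⟩
      · rintro ⟨a, ha, hb⟩
        exact ⟨a, ha, hb⟩
    have hS : IsMmSystem R M X ((P : Set X)ᶜ) := by
      refine ⟨⟨x, hxP⟩, fun h0 => h0 P.zero_mem, ?_⟩
      intro N A Z h1 h2
      rw [key] at h1 h2 ⊢
      intro h3
      rw [sup_le_iff] at h1 h2 h3
      rcases hprime N Z h3.2 with h4 | h4
      · exact h2 ⟨h3.1, h4⟩
      · exact h1 ⟨h3.1, h4⟩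
    obtain ⟨y, hy, hyY⟩ := hx _ hS hxP
    exact hy (hYP hyY)
  · intro hx S hS hxS
    by_contra hne
    obtain ⟨P, hYP, hmax⟩ := zorn_le_nonempty₀
      {Q : Submodule R X | ¬ ((Q : Set X) ∩ S).Nonempty}
      (by
        intro c hc hchain y hy
        refine ⟨sSup c, ?_, fun z hz => le_sSup hz⟩
        rintro ⟨a, ha, haS⟩
        rw [SetLike.mem_coe, Submodule.mem_sSup_of_directed ⟨y, hy⟩ hchain.directedOn] at ha
        obtain ⟨Q, hQ, haQ⟩ := ha
        exact hc hQ ⟨a, haQ, haS⟩)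
      Y (by rwa [Set.mem_setOf_eq, Set.inter_comm])
    have hPS : ¬ ((P : Set X) ∩ S).Nonempty := hmax.prop
    have key : ∀ A : Submodule R X, ¬ A ≤ P → ((↑(P ⊔ A) : Set X) ∩ S).Nonempty := by
      intro A hA
      by_contra hn
      exact hA (le_sup_right.trans (hmax.le_of_ge hn le_sup_left))
    have hprime : IsMPrimeSubmodule R M X P := by
      refine ⟨?_, ?_⟩
      · rintro rfl
        exact hPS ⟨x, trivial, hxS⟩
      · intro N Z hNZ
        by_contra! hcon
        have h3 := hS.2.2 N P Z (key _ hcon.2) (key _ hcon.1)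
        rw [sup_eq_left.mpr hNZ] at h3
        exact hPS h3
    exact hPS ⟨x, hx P ⟨hprime, hYP⟩, hxS⟩
end

section
/- Let X be an R-module and Y a submodule of X. Then rad_M(Y) ⊆ rad_M(X), where rad_M(Y) is computed with Y regarded as an R-module and viewed as a subset of X. -/
universe u v

theorem bprod_le_comap (R : Type*) [Ring R]
    (M : Type*) [AddCommGroup M] [Module R M]
    {A B : Type*} [AddCommGroup A] [Module R A] [AddCommGroup B] [Module R B]
    (g : A →ₗ[R] B) (N : Submodule R M) :
    bprod R M A N ≤ (bprod R M B N).comap g := by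
  intro a ha
  rw [Submodule.mem_comap]
  unfold bprod at ha ⊢
  rw [Submodule.mem_sInf] at ha ⊢
  intro W hW
  have := ha (W.comap g) (by
    intro f n hn
    have h := hW ((Submodule.mapQ (W.comap g) W g le_rfl).comp f) n hn
    rw [LinearMap.comp_apply] at h
    obtain ⟨y, hy⟩ := Submodule.Quotient.mk_surjective _ (f n)
    rw [← hy] at h ⊢
    rw [Submodule.mapQ_apply, Submodule.Quotient.mk_eq_zero] at h
    rw [Submodule.Quotient.mk_eq_zero]
    exact h)
  exact this

/-- Proposition 2.28: for a submodule `Y` of `X`, `rad_M(Y) ⊆ rad_M(X)`. -/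
theorem radM_submodule_le (R : Type u) [Ring R]
    (M : Type v) [AddCommGroup M] [Module R M]
    (X : Type v) [AddCommGroup X] [Module R X] (Y : Submodule R X) :
    (radM R M (↥Y)).map Y.subtype ≤ radM R M X := by
  refine le_sInf fun P hP => ?_
  rw [Submodule.map_le_iff_le_comap]
  by_cases hY : Y ≤ P
  · intro y _
    exact hY y.2
  refine sInf_le ⟨?_, ?_⟩
  · intro h
    apply hY
    intro y hy
    have : (⟨y, hy⟩ : Y) ∈ P.comap Y.subtype := by rw [h]; trivial
    exact this
  · intro N Z hZ
    have key : bprodSub R M X N (Z.map Y.subtype) ≤ P := by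
      rintro _ ⟨x, hx, rfl⟩
      let e := Submodule.equivMapOfInjective Y.subtype Y.injective_subtype Z
      have h1 := bprod_le_comap R M e.symm.toLinearMap N hx
      have h2 := hZ (Submodule.mem_map_of_mem (f := Z.subtype) h1)
      have h3 : ((e (e.symm x) : Z.map Y.subtype) : X) ∈ P := h2
      rw [e.apply_symm_apply] at h3
      exact h3
    rcases hP.2 N _ key with h | h
    · left
      exact (bprod_le_comap R M Y.subtype N).trans (Submodule.comap_mono h)
    · right
      exact Submodule.map_le_iff_le_comap.1 h
end

section
/- Assume M is projective in σ[M], and let X be a module in σ[M] that is the internal direct sum X = ⊕_{λ∈Λ} X_λ of a family of submodules X_λ (λ ∈ Λ). Then rad_M(X) = ⊕_{λ∈Λ} rad_M(X_λ), where each rad_M(X_λ) is computed with X_λ regarded as an R-module and viewed as a submodule of X. -/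
universe u v

section Helpers

variable {R : Type u} [Ring R] {M : Type v} [AddCommGroup M] [Module R M]

theorem MemSigma.of_injective {A B : Type v} [AddCommGroup A] [Module R A]
    [AddCommGroup B] [Module R B] (hB : MemSigma R M B) (h : A →ₗ[R] B)
    (hh : Function.Injective h) : MemSigma R M A := by
  obtain ⟨ι, K, g, hg⟩ := hB
  exact ⟨ι, K, g.comp h, hg.comp hh⟩

theorem MemSigma.sub {A : Type v} [AddCommGroup A] [Module R A] (hA : MemSigma R M A)
    (Y : Submodule R A) : MemSigma R M Y :=
  hA.of_injective Y.subtype Y.injective_subtype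

theorem MemSigma.quot {A : Type v} [AddCommGroup A] [Module R A] (hA : MemSigma R M A)
    (Y : Submodule R A) : MemSigma R M (A ⧸ Y) := by
  obtain ⟨ι, K, g, hg⟩ := hA
  let K' := (Y.map g).comap K.mkQ
  have hK : K ≤ LinearMap.ker K'.mkQ := by
    intro k hk
    have : K.mkQ k = 0 := by simpa using hk
    simp [K', this]
  let q : ((ι →₀ M) ⧸ K) →ₗ[R] (ι →₀ M) ⧸ K' := K.liftQ K'.mkQ hK
  have hq : ∀ z, q z = 0 ↔ z ∈ Y.map g := by
    intro z
    obtain ⟨w, rfl⟩ := K.mkQ_surjective z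
    simp [q, K']
  refine ⟨ι, K', Y.liftQ (q.comp g) ?_, ?_⟩
  · intro y hy
    exact (hq _).2 ⟨y, hy, rfl⟩
  · rw [← LinearMap.ker_eq_bot, eq_bot_iff]
    intro z hz
    obtain ⟨w, rfl⟩ := Y.mkQ_surjective z
    have h1 : q (g w) = 0 := hz
    obtain ⟨y, hy, hyw⟩ := (hq _).1 h1
    have := hg hyw
    subst this
    simpa using hy

theorem map_le_bprod {A : Type v} [AddCommGroup A] [Module R A] (N : Submodule R M)
    (f : M →ₗ[R] A) : N.map f ≤ bprod R M A N := by
  refine le_sInf fun Y hY => ?_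
  rintro _ ⟨n, hn, rfl⟩
  simpa using hY (Y.mkQ.comp f) n hn

theorem bprod_le (hproj : IsProjInSigma R M) {A : Type v} [AddCommGroup A] [Module R A]
    (hA : MemSigma R M A) (N : Submodule R M) (T : Submodule R A)
    (hT : ∀ f : M →ₗ[R] A, N.map f ≤ T) : bprod R M A N ≤ T := by
  refine sInf_le ?_
  intro g n hn
  obtain ⟨h, rfl⟩ := hproj A (A ⧸ T) hA (hA.quot T) T.mkQ T.mkQ_surjective g
  have : h n ∈ T := hT h ⟨n, hn, rfl⟩
  simpa using this

theorem bprod_map_le (hproj : IsProjInSigma R M) {A B : Type v} [AddCommGroup A] [Module R A]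
    [AddCommGroup B] [Module R B]
    (hA : MemSigma R M A) (N : Submodule R M) (h : A →ₗ[R] B) :
    (bprod R M A N).map h ≤ bprod R M B N := by
  rw [Submodule.map_le_iff_le_comap]
  refine bprod_le hproj hA N _ fun f => ?_
  rw [← Submodule.map_le_iff_le_comap, ← Submodule.map_comp]
  exact map_le_bprod N _

theorem bprod_le_map (hproj : IsProjInSigma R M) {A B : Type v} [AddCommGroup A] [Module R A]
    [AddCommGroup B] [Module R B]
    (hA : MemSigma R M A) (hB : MemSigma R M B) (N : Submodule R M) (h : A →ₗ[R] B)
    (hh : Function.Surjective h) :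
    bprod R M B N ≤ (bprod R M A N).map h := by
  refine bprod_le hproj hB N _ fun f => ?_
  obtain ⟨f', rfl⟩ := hproj A B hA hB h hh f
  rw [Submodule.map_comp]
  exact Submodule.map_mono (map_le_bprod N f')

/-- `N·h(Y) = h(N·Y)`. -/
theorem bprodSub_map (hproj : IsProjInSigma R M) {A B : Type v} [AddCommGroup A] [Module R A]
    [AddCommGroup B] [Module R B]
    (hA : MemSigma R M A) (hB : MemSigma R M B) (N : Submodule R M) (h : A →ₗ[R] B)
    (Y : Submodule R A) :
    bprodSub R M B N (Y.map h) = (bprodSub R M A N Y).map h := by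
  let h' : Y →ₗ[R] (Y.map h) := h.restrict (fun y hy => ⟨y, hy, rfl⟩)
  have hs : Function.Surjective h' := by
    rintro ⟨_, y, hy, rfl⟩
    exact ⟨⟨y, hy⟩, rfl⟩
  have e : bprod R M (Y.map h) N = (bprod R M Y N).map h' :=
    le_antisymm (bprod_le_map hproj (hA.sub _) (hB.sub _) N h' hs)
      (bprod_map_le hproj (hA.sub _) N h')
  unfold bprodSub
  rw [e, ← Submodule.map_comp, ← Submodule.map_comp]
  rfl

theorem radM_map_le (hproj : IsProjInSigma R M) {X : Type v} [AddCommGroup X] [Module R X]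
    (hX : MemSigma R M X) (Z : Submodule R X) :
    (radM R M Z).map Z.subtype ≤ radM R M X := by
  refine le_sInf fun P hP => ?_
  rw [Submodule.map_le_iff_le_comap]
  by_cases ht : P.comap Z.subtype = ⊤
  · rw [ht]; exact le_top
  refine sInf_le ⟨ht, fun N Y hNY => ?_⟩
  rw [← Submodule.map_le_iff_le_comap, ← bprodSub_map hproj (hX.sub _) hX] at hNY
  rcases hP.2 N _ hNY with h | h
  · left
    rw [← Submodule.map_le_iff_le_comap]
    exact (bprod_map_le hproj (hX.sub _) N _).trans h
  · right
    rwa [← Submodule.map_le_iff_le_comap]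

theorem radM_le_comap (hproj : IsProjInSigma R M) {X B : Type v} [AddCommGroup X] [Module R X]
    [AddCommGroup B] [Module R B]
    (hX : MemSigma R M X) (hB : MemSigma R M B) (p : X →ₗ[R] B) (hp : Function.Surjective p) :
    radM R M X ≤ (radM R M B).comap p := by
  rw [← Submodule.map_le_iff_le_comap]
  refine le_sInf fun P hP => ?_
  rw [Submodule.map_le_iff_le_comap]
  refine sInf_le ⟨?_, fun N Y hNY => ?_⟩
  · intro ht
    apply hP.1
    rw [eq_top_iff]
    intro b _
    obtain ⟨x, rfl⟩ := hp b
    have : x ∈ P.comap p := ht ▸ Submodule.mem_top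
    exact this
  rw [← Submodule.map_le_iff_le_comap, ← bprodSub_map hproj hX hB] at hNY
  rcases hP.2 N _ hNY with h | h
  · left
    rw [← Submodule.map_le_iff_le_comap]
    exact (bprod_map_le hproj hX N _).trans h
  · right
    rwa [← Submodule.map_le_iff_le_comap]

end Helpers

/-- Proposition 2.30: if `M` is projective in `σ[M]` and `X ∈ σ[M]` is the
internal direct sum of submodules `X_λ`, then `rad_M(X) = ⊕_λ rad_M(X_λ)`. -/
theorem radM_directSum (R : Type u) [Ring R]
    (M : Type v) [AddCommGroup M] [Module R M] (hproj : IsProjInSigma R M)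
    (X : Type v) [AddCommGroup X] [Module R X] (hX : MemSigma R M X)
    (Λ : Type*) (Xl : Λ → Submodule R X)
    (hind : iSupIndep Xl) (hsum : ⨆ l, Xl l = ⊤) :
    radM R M X = ⨆ l, (radM R M (↥(Xl l))).map (Xl l).subtype := by
  apply le_antisymm
  · intro x hx
    have hxt : x ∈ ⨆ l, Xl l := hsum ▸ Submodule.mem_top
    obtain ⟨f, hf, rfl⟩ := (Submodule.mem_iSup_iff_exists_finsupp _ _).1 hxt
    refine Submodule.sum_mem _ fun l hl => ?_
    refine Submodule.mem_iSup_of_mem l ?_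
    have hc : IsCompl (Xl l) (⨆ j, ⨆ (_ : j ≠ l), Xl j) := by
      refine ⟨hind l, ?_⟩
      rw [codisjoint_iff, eq_top_iff, ← hsum]
      refine iSup_le fun j => ?_
      by_cases hj : j = l
      · subst hj; exact le_sup_left
      · exact le_sup_of_le_right (le_iSup₂_of_le j hj le_rfl)
    let p := Submodule.projectionOnto _ _ hc
    have hp : Function.Surjective p := fun z =>
      ⟨z, Submodule.projectionOnto_apply_left hc z⟩
    have h1 : p (f.sum fun _ x => x) ∈ radM R M (Xl l) :=
      radM_le_comap hproj hX (hX.sub _) p hp hx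
    have h2 : p (f.sum fun _ x => x) = ⟨f l, hf l⟩ := by
      rw [Finsupp.sum, map_sum, Finset.sum_eq_single l]
      · exact Submodule.projectionOnto_apply_left hc ⟨f l, hf l⟩
      · intro j _ hj
        refine (Submodule.projectionOnto_apply_eq_zero_iff hc).2 ?_
        exact Submodule.mem_iSup_of_mem j (Submodule.mem_iSup_of_mem hj (hf j))
      · intro h; exact absurd hl h
    rw [h2] at h1
    exact ⟨_, h1, rfl⟩
  · exact iSup_le fun l => radM_map_le hproj hX (Xl l)
end

section
/- Assume M is projective in σ[M]. Then rad_R(M) ⊆ rad_M(M), where rad_R(M) denotes the intersection of all classical prime submodules of M (with rad_R(M) := M if M has no classical prime submodule) and rad_M(M) denotes the intersection of all M-prime submodules of M (with rad_M(M) := M if M has no M-prime submodule). -/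
universe u v

/-- A proper submodule `P` of `M` is a classical prime submodule if for every two-sided
ideal `I` of `R` and every submodule `Y` of `M`, `IY ⊆ P` implies `Y ⊆ P` or `IM ⊆ P`. -/
def IsClassicalPrimeSubmodule (R : Type u) [Ring R]
    (M : Type v) [AddCommGroup M] [Module R M] (P : Submodule R M) : Prop :=
  P ≠ ⊤ ∧ ∀ I : Ideal R, (∀ a ∈ I, ∀ r : R, a * r ∈ I) →
    ∀ Y : Submodule R M,
      Submodule.span R {z : M | ∃ a ∈ I, ∃ y ∈ Y, z = a • y} ≤ P →
      Y ≤ P ∨ Submodule.span R {z : M | ∃ a ∈ I, ∃ y : M, z = a • y} ≤ P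

/-- Corollary 3.8: if `M` is projective in `σ[M]`, then
`rad_R(M) ⊆ rad_M(M)`. -/
theorem radR_le_radM (R : Type u) [Ring R]
    (M : Type v) [AddCommGroup M] [Module R M] (hproj : IsProjInSigma R M) :
    sInf {P : Submodule R M | IsClassicalPrimeSubmodule R M P} ≤ radM R M M := by
  refine le_sInf ?_
  rintro P ⟨hP, hprime⟩
  refine sInf_le ⟨hP, ?_⟩
  intro I _ Y hIY
  have key : bprodSub R M M (Submodule.span R {z : M | ∃ a ∈ I, ∃ y : M, z = a • y}) Y ≤ P := by
    unfold bprodSub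
    rw [Submodule.map_le_iff_le_comap]
    refine sInf_le ?_
    intro f n hn
    have hle : Submodule.span R {z : M | ∃ a ∈ I, ∃ y : M, z = a • y} ≤ LinearMap.ker f := by
      rw [Submodule.span_le]
      rintro z ⟨a, ha, m, rfl⟩
      obtain ⟨y, hy⟩ := Submodule.Quotient.mk_surjective _ (f m)
      change f (a • m) = 0
      rw [map_smul, ← hy, ← Submodule.Quotient.mk_smul, Submodule.Quotient.mk_eq_zero]
      exact hIY (Submodule.subset_span ⟨a, ha, y, y.2, rfl⟩)
    exact hle hn
  rcases hprime _ _ key with h | h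
  · right
    refine le_trans (le_sInf ?_) h
    intro Z hZ n hn
    exact (Submodule.Quotient.mk_eq_zero Z).1 (hZ Z.mkQ n hn)
  · exact Or.inl h
end

section
/- Let M be an Artinian R-module which is an M-prime module (i.e., M ≠ 0 and (0) is an M-prime submodule of M). Then M is a homogeneous semisimple module, i.e., M is a direct sum of mutually isomorphic simple modules. -/
universe u v

/-- Proposition 5.1: an Artinian `M`-prime module `M` is homogeneous
semisimple. -/
theorem isHomogSemisimple_of_artinian_isMPrime (R : Type u) [Ring R]
    (M : Type v) [AddCommGroup M] [Module R M] [IsArtinian R M]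
    (h : IsMPrimeModule R M M) :
    IsHomogSemisimple R M := by
  obtain ⟨hne, hp⟩ := h
  have hnt : Nontrivial M := by
    by_contra hc
    rw [not_nontrivial_iff_subsingleton] at hc
    exact hne (Subsingleton.elim _ _)
  obtain ⟨S, hS⟩ := IsAtomic.exists_atom (Submodule R M)
  have hSb : S ≠ ⊥ := hS.1
  rw [← isSimpleModule_iff_isAtom] at hS
  -- the annihilator of `S` in `M` is zero
  have hprod : bprod R M S (annM R M S) = ⊥ := by
    rw [eq_bot_iff]
    refine sInf_le ?_
    intro f n hn
    have h1 := (Submodule.mem_iInf _).1 hn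
      ((Submodule.quotEquivOfEqBot (⊥ : Submodule R S) rfl).toLinearMap.comp f)
    simpa using h1
  have hann : ∀ x : M, (∀ f : M →ₗ[R] S, f x = 0) → x = 0 := by
    intro x hx
    have hxN : x ∈ annM R M S := (Submodule.mem_iInf _).2 hx
    have hb : bprod R M M (annM R M S) ≤ ⊥ := by
      rcases hp (annM R M S) S (by simp [bprodSub, hprod]) with h1 | h1
      · exact h1
      · exact absurd (le_bot_iff.1 h1) hSb
    have hmem : x ∈ bprod R M M (annM R M S) := by
      refine (Submodule.mem_sInf).2 fun Y hY => ?_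
      exact (Submodule.Quotient.mk_eq_zero Y).1 (hY Y.mkQ x hxN)
    simpa using hb hmem
  obtain ⟨s, hs⟩ := Finset.exists_inf_le (fun f : M →ₗ[R] S => LinearMap.ker f)
  have hss : IsSemisimpleModule R M := by
    refine IsSemisimpleModule.of_injective
      (LinearMap.pi fun f : s => f.1 : M →ₗ[R] (s → S)) ?_
    refine (injective_iff_map_eq_zero _).2 fun x hx => hann x fun f => ?_
    exact hs f (Submodule.mem_finsetInf.2 fun g hg => congr_fun hx ⟨g, hg⟩)
  have hiso : IsIsotypicOfType R M S := by
    intro m hm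
    have := IsSimpleModule.nontrivial R m
    obtain ⟨x, hx⟩ := exists_ne (0 : m)
    have : ∃ f : M →ₗ[R] S, f x ≠ 0 := by
      by_contra! hc
      exact hx (Subtype.ext (hann x hc))
    obtain ⟨f, hf⟩ := this
    have h0 : f.comp m.subtype ≠ 0 := fun h => hf (LinearMap.congr_fun h x)
    exact ⟨LinearEquiv.ofBijective _ (LinearMap.bijective_of_ne_zero h0)⟩
  obtain ⟨ι, e⟩ := hiso.linearEquiv_finsupp
  exact ⟨S, inferInstance, inferInstance, ι, hS, e⟩
end

section
/- Assume M is projective in σ[M] and M is an Artinian R-module. Then every prime M-ideal P of M is virtually maximal (i.e., M/P is a homogeneous semisimple module), and M/P(M) is a Noetherian R-module. -/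
universe u v

theorem aux_bprod_eq_bot {R : Type*} [Ring R] {M : Type*} [AddCommGroup M] [Module R M]
    {X : Type*} [AddCommGroup X] [Module R X] {N : Submodule R M} (h : N ≤ annM R M X) :
    bprod R M X N = ⊥ := by
  refine le_bot_iff.mp (sInf_le ?_)
  intro f n hn
  have h1 := h hn
  simp only [annM, Submodule.mem_iInf, LinearMap.mem_ker] at h1
  have h2 := h1 ((Submodule.quotEquivOfEqBot (⊥ : Submodule R X) rfl).toLinearMap ∘ₗ f)
  simpa using h2

theorem aux_le_annM {R : Type*} [Ring R] {M : Type*} [AddCommGroup M] [Module R M]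
    {X : Type*} [AddCommGroup X] [Module R X] {N : Submodule R M} (h : bprod R M X N = ⊥) :
    N ≤ annM R M X := by
  intro n hn
  simp only [annM, Submodule.mem_iInf, LinearMap.mem_ker]
  intro f
  rw [← Submodule.mem_bot R, ← h, bprod, Submodule.mem_sInf]
  intro Y hY
  have := hY (Y.mkQ ∘ₗ f) n hn
  simpa using this

theorem aux_embed {R : Type u} [Ring R] {M : Type v} [AddCommGroup M] [Module R M]
    [IsArtinian R M] {P : Submodule R M} (hP : IsPrimeMIdeal R M P) :
    ∃ (S : Type v) (_ : AddCommGroup S) (_ : Module R S) (t : Finset (M →ₗ[R] S)),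
      IsSimpleModule R S ∧ ∃ g : (M ⧸ P) →ₗ[R] (t → S), Function.Injective g := by
  obtain ⟨-, hne, X, _, _, hX, hPX⟩ := hP
  have hf : ∃ f : M →ₗ[R] X, f ≠ 0 := by
    by_contra! hcon
    apply hne
    rw [hPX, annM, iInf_eq_top]
    intro f
    rw [hcon f, LinearMap.ker_zero]
  obtain ⟨f, hf⟩ := hf
  have : IsArtinian R (LinearMap.range f) := inferInstance
  have hnt : (⊤ : Submodule R (LinearMap.range f)) ≠ ⊥ := by
    intro h
    apply hf
    ext m
    have : (⟨f m, m, rfl⟩ : LinearMap.range f) ∈ (⊤ : Submodule R (LinearMap.range f)) := trivial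
    rw [h, Submodule.mem_bot] at this
    exact congrArg Subtype.val this
  obtain ⟨S', hS', -⟩ := (IsAtomic.eq_bot_or_exists_atom_le
    (⊤ : Submodule R (LinearMap.range f))).resolve_left hnt
  rw [← isSimpleModule_iff_isAtom] at hS'
  let S : Submodule R X := S'.map (LinearMap.range f).subtype
  have hS : IsSimpleModule R S := IsSimpleModule.congr
    (S'.equivMapOfInjective _ (LinearMap.range f).subtype_injective).symm
  have hSP : annM R M S ≤ P := by
    have h := hX.2 (annM R M S) S (by
      rw [bprodSub, aux_bprod_eq_bot le_rfl, Submodule.map_bot])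
    rcases h with h | h
    · rw [hPX]
      exact aux_le_annM (le_bot_iff.mp h)
    · exact absurd (le_bot_iff.mp h) ((isSimpleModule_iff_isAtom.mp hS).1)
  have hPS : ∀ g : M →ₗ[R] S, P ≤ LinearMap.ker g := by
    intro g m hm
    rw [hPX] at hm
    simp only [annM, Submodule.mem_iInf, LinearMap.mem_ker] at hm
    have := hm (S.subtype ∘ₗ g)
    simpa using this
  obtain ⟨t, ht⟩ := Finset.exists_inf_le (fun g : M →ₗ[R] S => LinearMap.ker g)
  refine ⟨S, inferInstance, inferInstance, t, hS,
    P.liftQ (LinearMap.pi fun g : t => g.1) ?_, ?_⟩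
  · intro m hm
    rw [LinearMap.mem_ker]
    ext g
    exact congrArg _ (hPS g.1 hm)
  · rw [← LinearMap.ker_eq_bot]
    apply Submodule.ker_liftQ_eq_bot
    intro m hm
    apply hSP
    simp only [annM, Submodule.mem_iInf]
    intro g
    apply ht g
    rw [Submodule.mem_finsetInf]
    intro g' hg'
    exact congrFun (LinearMap.mem_ker.mp hm) ⟨g', hg'⟩

theorem aux_noeth {R : Type u} [Ring R] {M : Type v} [AddCommGroup M] [Module R M]
    [IsArtinian R M] {P : Submodule R M} (hP : IsPrimeMIdeal R M P) :
    IsNoetherian R (M ⧸ P) := by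
  obtain ⟨S, _, _, t, hS, g, hg⟩ := aux_embed hP
  exact isNoetherian_of_injective g hg

theorem aux_homog {R : Type u} [Ring R] {M : Type v} [AddCommGroup M] [Module R M]
    [IsArtinian R M] {P : Submodule R M} (hP : IsPrimeMIdeal R M P) :
    IsHomogSemisimple R (M ⧸ P) := by
  obtain ⟨S, _, _, t, hS, g, hg⟩ := aux_embed hP
  have : IsSemisimpleModule R (M ⧸ P) := IsSemisimpleModule.of_injective g hg
  have hiso : IsIsotypicOfType R (M ⧸ P) S := by
    intro m hm
    have := IsSimpleModule.nontrivial R m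
    obtain ⟨x, hx⟩ := exists_ne (0 : m)
    have hgx : g x ≠ 0 := by
      intro h
      apply hx
      apply Subtype.ext
      apply hg
      simpa using h
    obtain ⟨i, hi⟩ := Function.ne_iff.mp hgx
    let φ : m →ₗ[R] S := LinearMap.proj i ∘ₗ g ∘ₗ m.subtype
    have hφ : φ ≠ 0 := fun h => hi (LinearMap.congr_fun h x)
    exact ⟨LinearEquiv.ofBijective φ (LinearMap.bijective_of_ne_zero hφ)⟩
  obtain ⟨ι, e⟩ := hiso.linearEquiv_finsupp
  exact ⟨S, _, _, ι, hS, e⟩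

/-- Theorem 5.6: if `M` is projective in `σ[M]` and Artinian, then every
prime `M`-ideal `P` is virtually maximal (`M/P` is homogeneous semisimple) and `M/P(M)`
is Noetherian. -/
theorem primeMIdeal_virtuallyMaximal_and_noetherian (R : Type u) [Ring R]
    (M : Type v) [AddCommGroup M] [Module R M] (hproj : IsProjInSigma R M)
    [IsArtinian R M] :
    (∀ P : Submodule R M, IsPrimeMIdeal R M P →
      P ≠ ⊤ ∧ IsHomogSemisimple R (M ⧸ P)) ∧
    IsNoetherian R (M ⧸ primeRadM R M) := by
  refine ⟨fun P hP => ⟨hP.2.1, aux_homog hP⟩, ?_⟩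
  obtain ⟨t, ht⟩ := Finset.exists_inf_le
    (Subtype.val (p := fun P : Submodule R M => IsPrimeMIdeal R M P))
  have : ∀ P : t, IsNoetherian R (M ⧸ P.1.1) := fun P => aux_noeth P.1.2
  let g : M →ₗ[R] ((P : t) → M ⧸ P.1.1) := LinearMap.pi fun P => P.1.1.mkQ
  have hle : primeRadM R M ≤ LinearMap.ker g := by
    intro m hm
    rw [LinearMap.mem_ker]
    ext P
    have : m ∈ P.1.1 := (Submodule.mem_sInf.mp hm) _ P.1.2
    simpa [g] using this
  refine isNoetherian_of_injective ((primeRadM R M).liftQ g hle) ?_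
  rw [← LinearMap.ker_eq_bot]
  apply Submodule.ker_liftQ_eq_bot
  intro m hm
  refine Submodule.mem_sInf.mpr fun P hP => ht ⟨P, hP⟩ ?_
  rw [Submodule.mem_finsetInf]
  intro Q hQ
  have := congrFun (LinearMap.mem_ker.mp hm) ⟨Q, hQ⟩
  simpa [g] using this
end

section
/- Assume M is projective in σ[M] and M is an Artinian R-module. Then either P(M) = M, or there exist finitely many primitive M-ideals P₁, …, P_n of M such that P(M) = P₁ ∩ … ∩ P_n. -/
universe u v

theorem aux_annM_le (R : Type u) [Ring R]
    (M : Type v) [AddCommGroup M] [Module R M] (X : Type v) [AddCommGroup X] [Module R X]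
    (hX : IsMPrimeModule R M X) (Y : Submodule R X) (hY : Y ≠ ⊥) :
    annM R M Y = annM R M X := by
  apply le_antisymm
  · have key : bprodSub R M X (annM R M Y) Y ≤ ⊥ := by
      have h0 : bprod R M Y (annM R M Y) = ⊥ := by
        rw [eq_bot_iff]
        apply sInf_le
        intro f n hn
        have h1 := (Submodule.mem_iInf _).1 hn
          ((Submodule.quotEquivOfEqBot (⊥ : Submodule R Y) rfl).toLinearMap.comp f)
        simpa using h1
      unfold bprodSub
      rw [h0, Submodule.map_bot]
    rcases hX.2 _ _ key with h | h
    · intro n hn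
      refine (Submodule.mem_iInf _).2 fun f => ?_
      have : f n ∈ bprod R M X (annM R M Y) := by
        refine (Submodule.mem_sInf).2 fun Z hZ => ?_
        have := hZ (Z.mkQ.comp f) n hn
        simpa using this
      simpa using h this
    · exact absurd (eq_bot_iff.2 h) hY
  · intro n hn
    refine (Submodule.mem_iInf _).2 fun f => ?_
    have := (Submodule.mem_iInf _).1 hn (Y.subtype.comp f)
    simpa using this

theorem aux_primitive (R : Type u) [Ring R]
    (M : Type v) [AddCommGroup M] [Module R M] [IsArtinian R M] (P : Submodule R M)
    (hP : IsPrimeMIdeal R M P) : IsPrimitiveMIdeal R M P := by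
  obtain ⟨hI, hne, X, _, _, hX, rfl⟩ := hP
  have : ∃ f : M →ₗ[R] X, f ≠ 0 := by
    by_contra! h
    apply hne
    rw [eq_top_iff]
    intro n _
    refine (Submodule.mem_iInf _).2 fun f => ?_
    simp [h f]
  obtain ⟨f, hf⟩ := this
  have hart : IsArtinian R (LinearMap.range f) :=
    isArtinian_of_surjective M f.rangeRestrict f.surjective_rangeRestrict
  have hnt : (⊤ : Submodule R (LinearMap.range f)) ≠ ⊥ := by
    intro h
    apply hf
    rw [← LinearMap.range_eq_bot, eq_bot_iff]
    intro x hx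
    have : (⟨x, hx⟩ : LinearMap.range f) ∈ (⊥ : Submodule R (LinearMap.range f)) := by
      rw [← h]; trivial
    simpa using this
  obtain ⟨a, ha, -⟩ := (eq_bot_or_exists_atom_le (⊤ : Submodule R (LinearMap.range f))).resolve_left hnt
  have hs : IsSimpleModule R a := isSimpleModule_iff_isAtom.2 ha
  have e := Submodule.equivMapOfInjective (LinearMap.range f).subtype
    (Submodule.injective_subtype _) a
  have hs' := IsSimpleModule.congr e.symm
  refine ⟨hI, _, inferInstance, inferInstance, hs', (aux_annM_le R M X hX _ ?_).symm⟩
  intro h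
  exact ha.1 (Submodule.map_injective_of_injective (Submodule.injective_subtype _) (h.trans (Submodule.map_bot _).symm))

/-- Theorem 5.7: if `M` is projective in `σ[M]` and Artinian, then
`P(M) = M` or `P(M)` is a finite intersection of primitive `M`-ideals. -/
theorem primeRadM_eq_top_or_finite_inter_primitive (R : Type u) [Ring R]
    (M : Type v) [AddCommGroup M] [Module R M] (hproj : IsProjInSigma R M)
    [IsArtinian R M] :
    primeRadM R M = ⊤ ∨
      ∃ (n : ℕ) (P : Fin (n + 1) → Submodule R M),
        (∀ i, IsPrimitiveMIdeal R M (P i)) ∧ primeRadM R M = ⨅ i, P i := by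
  rcases Set.eq_empty_or_nonempty {P : Submodule R M | IsPrimeMIdeal R M P} with he | ⟨P₀, hP₀⟩
  · left
    unfold primeRadM
    rw [he, sInf_empty]
  · right
    obtain ⟨Q, ⟨n, P, hP, rfl⟩, hmin⟩ := IsArtinian.set_has_minimal
      {Q : Submodule R M | ∃ (n : ℕ) (P : Fin (n + 1) → Submodule R M),
        (∀ i, IsPrimeMIdeal R M (P i)) ∧ Q = ⨅ i, P i}
      ⟨_, 0, fun _ => P₀, fun _ => hP₀, rfl⟩
    refine ⟨n, P, fun i => aux_primitive R M _ (hP i), le_antisymm ?_ ?_⟩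
    · exact le_iInf fun i => sInf_le (hP i)
    · refine le_sInf fun P' hP' => ?_
      have h1 := hmin (⨅ i, (Fin.cons P' P : Fin (n + 1 + 1) → Submodule R M) i)
        ⟨n + 1, Fin.cons P' P, fun i => by
          refine Fin.cases ?_ (fun j => ?_) i
          · simpa using hP'
          · simpa using hP j, rfl⟩
      have h2 : (⨅ i, (Fin.cons P' P : Fin (n + 1 + 1) → Submodule R M) i) ≤ ⨅ i, P i :=
        le_iInf fun j => (iInf_le _ j.succ).trans (by simp)
      have h3 : (⨅ i, (Fin.cons P' P : Fin (n + 1 + 1) → Submodule R M) i) ≤ P' :=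
        (iInf_le _ 0).trans (by simp)
      rcases h2.lt_or_eq with h | h
      · exact absurd h h1
      · exact h ▸ h3
end

section
/- Let X be a Noetherian R-module. If every M-prime submodule P of X is virtually maximal (i.e., X/P is a homogeneous semisimple module), then X/rad_M(X) is an Artinian R-module. -/
universe u v

/-- Intersection of two submodules with Artinian quotients has Artinian quotient. -/
theorem aux_inf_artinian {R : Type*} [Ring R] {X : Type*} [AddCommGroup X] [Module R X]
    (A B : Submodule R X) (hA : IsArtinian R (X ⧸ A)) (hB : IsArtinian R (X ⧸ B)) :
    IsArtinian R (X ⧸ (A ⊓ B)) := by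
  have hk : LinearMap.ker (A.mkQ.prod B.mkQ) = A ⊓ B := by
    rw [LinearMap.ker_prod, Submodule.ker_mkQ, Submodule.ker_mkQ]
  refine isArtinian_of_injective ((A ⊓ B).liftQ (A.mkQ.prod B.mkQ) hk.ge) ?_
  rw [← LinearMap.ker_eq_bot]
  exact Submodule.ker_liftQ_eq_bot _ _ _ hk.le

/-- A Noetherian homogeneous semisimple module is Artinian. -/
theorem aux_homog_artinian {R : Type u} [Ring R] {X : Type v} [AddCommGroup X] [Module R X]
    [IsNoetherian R X] (h : IsHomogSemisimple R X) : IsArtinian R X := by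
  obtain ⟨S, _, _, ι, hS, ⟨e⟩⟩ := h
  have : IsSemisimpleModule R X := IsSemisimpleModule.congr e
  exact ((IsSemisimpleModule.finite_tfae (R := R) (M := X)).out 1 2).mp ‹_›

/-- Theorem 5.9: if `X` is Noetherian and every `M`-prime submodule `P` of
`X` is virtually maximal, then `X/rad_M(X)` is Artinian. -/
theorem artinian_quotient_radM (R : Type u) [Ring R]
    (M : Type v) [AddCommGroup M] [Module R M]
    (X : Type v) [AddCommGroup X] [Module R X] [IsNoetherian R X]
    (h : ∀ P : Submodule R X, IsMPrimeSubmodule R M X P → IsHomogSemisimple R (X ⧸ P)) :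
    IsArtinian R (X ⧸ radM R M X) := by
  have key : ∀ K : Submodule R X,
      IsArtinian R (X ⧸ sInf {P : Submodule R X | IsMPrimeSubmodule R M X P ∧ K ≤ P}) := by
    intro K
    induction K using WellFoundedGT.induction with
    | ind K ih =>
    by_cases hK : IsMPrimeSubmodule R M X K
    · have : sInf {P : Submodule R X | IsMPrimeSubmodule R M X P ∧ K ≤ P} = K :=
        le_antisymm (sInf_le ⟨hK, le_rfl⟩) (le_sInf fun P hP => hP.2)
      rw [this]
      exact aux_homog_artinian (h K hK)
    by_cases hT : K = ⊤
    · have : sInf {P : Submodule R X | IsMPrimeSubmodule R M X P ∧ K ≤ P} = ⊤ := by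
        refine top_le_iff.mp (le_sInf fun P hP => ?_)
        rw [← hT]
        exact hP.2
      rw [this]
      have : Subsingleton (X ⧸ (⊤ : Submodule R X)) := 
        Submodule.Quotient.subsingleton_iff.mpr rfl
      infer_instance
    unfold IsMPrimeSubmodule at hK
    push Not at hK
    obtain ⟨N, Y, h1, h2, h3⟩ := hK hT
    have hA := ih (K ⊔ bprod R M X N) (left_lt_sup.mpr h2)
    have hB := ih (K ⊔ Y) (left_lt_sup.mpr h3)
    have heq : sInf {P : Submodule R X | IsMPrimeSubmodule R M X P ∧ K ≤ P} =
        sInf {P : Submodule R X | IsMPrimeSubmodule R M X P ∧ K ⊔ bprod R M X N ≤ P} ⊓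
        sInf {P : Submodule R X | IsMPrimeSubmodule R M X P ∧ K ⊔ Y ≤ P} := by
      apply le_antisymm
      · exact le_inf (le_sInf fun P hP => sInf_le ⟨hP.1, le_sup_left.trans hP.2⟩)
          (le_sInf fun P hP => sInf_le ⟨hP.1, le_sup_left.trans hP.2⟩)
      · refine le_sInf fun P hP => ?_
        rcases hP.1.2 N Y (h1.trans hP.2) with h' | h'
        · exact inf_le_left.trans (sInf_le ⟨hP.1, sup_le hP.2 h'⟩)
        · exact inf_le_right.trans (sInf_le ⟨hP.1, sup_le hP.2 h'⟩)
    rw [heq]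
    exact aux_inf_artinian _ _ hA hB
  have := key ⊥
  have e : radM R M X = sInf {P : Submodule R X | IsMPrimeSubmodule R M X P ∧ ⊥ ≤ P} := by
    simp only [radM, bot_le, and_true]
  rw [e]
  exact this
end
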